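/- Let d ∈ N, 2 < p < ∞, and define r by 1/r = 1/2 − 1/p. Let w : Z^d → (0,∞) be a weight satisfying ∑_{k∈Z^d} w(k)^{-r} < ∞. Then F_d(w) embeds into L_p(T^d), and for every n ∈ N one has a_n(I_d : F_d(w) → L_p(T^d)) ≤ (∑_{j=n}^∞ σ_j^r)^{1/r}. -/

import Mathlib

open MeasureTheory Filter
open scoped ENNReal NNReal

noncomputable section

/-- The index lattice `ℤ^d`. -/
abbrev ZLat (d : ℕ) := Fin d → ℤ

instance fact_two_pi_pos : Fact (0 < 2 * Real.pi) := ⟨by positivity⟩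

/-- The `d`-dimensional torus `𝕋^d = [0,2π]^d` with endpoints identified. -/
abbrev Torus (d : ℕ) := Fin d → AddCircle (2 * Real.pi)

/-- The normalized Lebesgue measure `(2π)^{-d} dx` on the `d`-torus. -/
def torusMeasure (d : ℕ) : Measure (Torus d) :=
  ((ENNReal.ofReal (2 * Real.pi))⁻¹) ^ d • Measure.pi fun _ => volume

/-- The character `e^{i k·x}` on the `d`-torus. -/
def torusChar {d : ℕ} (k : ZLat d) (x : Torus d) : ℂ :=
  ∏ j, fourier (k j) (x j)

/-- The `k`-th Fourier coefficient `f̂(k) = (2π)^{-d} ∫_{𝕋^d} f(x) e^{-i k·x} dx`. -/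
def fourierCoef {d : ℕ} (f : Torus d → ℂ) (k : ZLat d) : ℂ :=
  ∫ x, (starRingEnd ℂ) (torusChar k x) * f x ∂(torusMeasure d)

/-- The `n`-th approximation number of a bounded linear operator `T`:
`a_n(T) = inf {‖T - A‖ : rank A < n}`. -/
def approxNum {X Y : Type*} [NormedAddCommGroup X] [NormedSpace ℂ X]
    [NormedAddCommGroup Y] [NormedSpace ℂ Y] (T : X →L[ℂ] Y) (n : ℕ) : ℝ :=
  sInf {c : ℝ | ∃ A : X →L[ℂ] Y,
    Module.rank ℂ (LinearMap.range (A : X →ₗ[ℂ] Y)) < n ∧ c = ‖T - A‖}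

/-- `ℓ²(ℤ^d)`; an isometric model of the Hilbert space `F_d(w)` via `f ↦ (w(k)·f̂(k))_k`.
Under this identification the embedding `I_d : F_d(w) → G` is characterized by the
property that the function `T c` has Fourier coefficients `c(k)/w(k)`. -/
abbrev ellTwo (d : ℕ) := lp (fun _ : ZLat d => ℂ) 2

/-- `ℓ¹(ℤ^d)`; an isometric model of the Wiener algebra `A(𝕋^d)` via `f ↦ (f̂(k))_k`. -/
abbrev ellOne (d : ℕ) := lp (fun _ : ZLat d => ℂ) 1

/-- `ℓ^∞(ℤ^d)`; an isometric model of the space `ℬ(𝕋^d)` of distributions with bounded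
Fourier coefficients. -/
abbrev ellInfty (d : ℕ) := lp (fun _ : ZLat d => ℂ) ⊤

lemma rpow_mul_abs_log_le {u B a b t : ℝ} (hu : 0 ≤ u) (huB : u ≤ B) (hB : 1 ≤ B)
    (ha : 0 < a) (hat : a ≤ t) (htb : t ≤ b) :
    u ^ t * |Real.log u| ≤ 1 / a + B ^ b * B := by
  have hB' : 0 ≤ B ^ b * B := by positivity
  rcases hu.eq_or_lt with rfl | hu'
  · simp only [Real.log_zero, abs_zero, mul_zero]; positivity
  rcases le_total u 1 with h1 | h1
  · have := Real.abs_log_mul_self_rpow_lt u t hu' h1 (ha.trans_le hat)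
    rw [abs_mul, abs_of_nonneg (Real.rpow_nonneg hu t), mul_comm] at this
    have h2 := one_div_le_one_div_of_le ha hat
    linarith
  · have h2 : |Real.log u| ≤ B := by
      rw [abs_of_nonneg (Real.log_nonneg h1)]
      exact (Real.log_le_self hu).trans huB
    have h3 : u ^ t ≤ B ^ b :=
      (Real.rpow_le_rpow hu huB (by linarith)).trans (Real.rpow_le_rpow_of_exponent_le hB htb)
    have : u ^ t * |Real.log u| ≤ B ^ b * B := by gcongr
    have : 0 < 1 / a := by positivity
    linarith

lemma measurable_ofReal_cpow {X : Type*} [MeasurableSpace X] {u : X → ℝ}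
    (hu : Measurable u) (z : ℂ) : Measurable fun x => (u x : ℂ) ^ z := by
  fun_prop

lemma norm_cpow_le_of_le {u B b : ℝ} {z : ℂ} (hu : 0 ≤ u) (huB : u ≤ B) (hB : 1 ≤ B)
    (hz : 0 < z.re) (hzb : z.re ≤ b) : ‖(u : ℂ) ^ z‖ ≤ B ^ b := by
  rw [Complex.norm_cpow_eq_rpow_re_of_nonneg hu hz.ne']
  exact (Real.rpow_le_rpow hu huB hz.le).trans (Real.rpow_le_rpow_of_exponent_le hB hzb)

lemma differentiableAt_integral_mul_cpow {X : Type*} [MeasurableSpace X] (μ : Measure X)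
    [IsFiniteMeasure μ] {ψ : X → ℂ} {u : X → ℝ} (hψ : Measurable ψ) (hu : Measurable u)
    {C B : ℝ} (hψC : ∀ x, ‖ψ x‖ ≤ C) (hu0 : ∀ x, 0 ≤ u x) (huB : ∀ x, u x ≤ B) (hB : 1 ≤ B)
    {s : ℂ} (hs : 0 < s.re) :
    DifferentiableAt ℂ (fun z : ℂ => ∫ x, ψ x * (u x : ℂ) ^ z ∂μ) s := by
  set a := s.re / 2 with ha
  have ha0 : 0 < a := by positivity
  have hre : ∀ z ∈ Metric.ball s a, a ≤ z.re ∧ z.re ≤ 3 * a := by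
    intro z hz
    have h1 := (Complex.abs_re_le_norm (z - s)).trans_lt (mem_ball_iff_norm.1 hz)
    rw [Complex.sub_re, abs_lt] at h1
    constructor <;> linarith
  refine (hasDerivAt_integral_of_dominated_loc_of_deriv_le (μ := μ) (s := Metric.ball s a)
    (F' := fun z x => ψ x * ((u x : ℂ) ^ z * Complex.log (u x)))
    (bound := fun _ => C * (1 / a + B ^ (3 * a) * B))
    (Metric.ball_mem_nhds s ha0) (Eventually.of_forall fun z => ?_) ?_ ?_
    (Eventually.of_forall fun x z hz => ?_) (integrable_const _)
    (Eventually.of_forall fun x z hz => ?_)).2.differentiableAt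
  · exact (hψ.mul (measurable_ofReal_cpow hu z)).aestronglyMeasurable
  · refine Integrable.of_bound (C := C * B ^ s.re)
      (hψ.mul (measurable_ofReal_cpow hu s)).aestronglyMeasurable
      (Eventually.of_forall fun x => ?_)
    rw [norm_mul]
    have := (norm_nonneg _).trans (hψC x)
    gcongr
    exacts [hψC x, norm_cpow_le_of_le (hu0 x) (huB x) hB hs le_rfl]
  · refine (hψ.mul ((measurable_ofReal_cpow hu s).mul ?_)).aestronglyMeasurable
    fun_prop
  · obtain ⟨h1, h2⟩ := hre z hz
    rw [norm_mul, norm_mul, Complex.norm_cpow_eq_rpow_re_of_nonneg (hu0 x) (by linarith),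
      ← Complex.ofReal_log (hu0 x), Complex.norm_real, Real.norm_eq_abs]
    exact mul_le_mul (hψC x) (rpow_mul_abs_log_le (hu0 x) (huB x) hB ha0 h1 h2)
      (mul_nonneg (Real.rpow_nonneg (hu0 x) _) (abs_nonneg _)) ((norm_nonneg _).trans (hψC x))
  · have hz0 : z ≠ 0 := by
      rintro rfl
      have := (hre 0 hz).1
      simp at this; linarith
    simpa using ((hasDerivAt_id z).const_cpow (c := (u x : ℂ)) (Or.inr hz0)).const_mul (ψ x)

lemma norm_mul_norm_cpow_sub_one {c a : ℂ} (hc : ‖c‖ = ‖a‖) {w : ℂ} (hw : 0 < w.re) :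
    ‖c * (‖a‖ : ℂ) ^ (w - 1)‖ = ‖a‖ ^ w.re := by
  rcases (norm_nonneg a).eq_or_lt with h | h
  · rw [norm_mul, hc, ← h, zero_mul, Real.zero_rpow hw.ne']
  · rw [norm_mul, hc, Complex.norm_cpow_eq_rpow_re_of_pos h, Complex.sub_re, Complex.one_re,
      Real.rpow_sub_one h.ne']
    field_simp

lemma differentiable_mul_norm_cpow (a : ℂ) {h : ℂ → ℂ} (hh : Differentiable ℂ h) :
    Differentiable ℂ fun z => a * (‖a‖ : ℂ) ^ h z := by
  rcases eq_or_ne a 0 with rfl | ha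
  · simp
  · intro z
    exact (((hh z).hasDerivAt.const_cpow (Or.inl (by simpa using ha))).const_mul a).differentiableAt

/-- **Hausdorff-Young inequality** for uniformly bounded systems satisfying Bessel's
inequality. -/
theorem hausdorff_young {X ι : Type*} [MeasurableSpace X] (μ : Measure X) [IsProbabilityMeasure μ]
    {χ : ι → X → ℂ} (hχ : ∀ i, Measurable (χ i)) (hχ1 : ∀ i x, ‖χ i x‖ ≤ 1) (s : Finset ι)
    (hbessel : ∀ b : ι → ℂ, ∫ x, ‖∑ i ∈ s, b i * χ i x‖ ^ 2 ∂μ ≤ ∑ i ∈ s, ‖b i‖ ^ 2)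
    (a : ι → ℂ) {p q : ℝ} (hp : 2 < p) (hpq : p.HolderConjugate q) :
    (∫ x, ‖∑ i ∈ s, a i * χ i x‖ ^ p ∂μ) ^ (1 / p) ≤ (∑ i ∈ s, ‖a i‖ ^ q) ^ (1 / q) := by
  have hp0 : 0 < p := by linarith
  have hq0 : 0 < q := hpq.symm.pos
  have hq1 : q * (1 - 1 / p) = 1 := by
    have := hpq.inv_add_inv_eq_one
    field_simp at this ⊢
    linarith
  set f : X → ℂ := fun x => ∑ i ∈ s, a i * χ i x with hf
  set N : ℝ := ∑ i ∈ s, ‖a i‖ ^ q with hN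
  set I : ℝ := ∫ x, ‖f x‖ ^ p ∂μ with hI
  have hN0 : 0 ≤ N := Finset.sum_nonneg fun i _ => by positivity
  have hI0 : 0 ≤ I := integral_nonneg fun x => by positivity
  have hfm : Measurable f := by fun_prop
  have hsum_le : ∀ (b : ι → ℂ) x, ‖∑ i ∈ s, b i * χ i x‖ ≤ ∑ i ∈ s, ‖b i‖ := fun b x =>
    norm_sum_le_of_le s fun i _ => by
      rw [norm_mul]
      exact mul_le_of_le_one_right (norm_nonneg _) (hχ1 i x)
  set B : ℝ := max 1 (∑ i ∈ s, ‖a i‖)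
  have hB : 1 ≤ B := le_max_left _ _
  have hfB : ∀ x, ‖f x‖ ≤ B := fun x => (hsum_le a x).trans (le_max_right _ _)
  have haB : ∀ i ∈ s, ‖a i‖ ≤ B := fun i hi =>
    (Finset.single_le_sum (f := fun i => ‖a i‖) (fun _ _ => norm_nonneg _) hi).trans
      (le_max_right _ _)
  set α : ι → ℂ → ℂ := fun i z => a i * (‖a i‖ : ℂ) ^ (q * (1 + z) / 2 - 1) with hα
  set g : ℂ → X → ℂ := fun z x =>
    (starRingEnd ℂ) (f x) * (‖f x‖ : ℂ) ^ (p * (1 + z) / 2 - 1) with hg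
  have hre : ∀ (t : ℝ) (z : ℂ), (t * (1 + z) / 2 : ℂ).re = t * (1 + z.re) / 2 := by
    intro t z
    simp
  have hαn : ∀ i (z : ℂ), 0 ≤ z.re → ‖α i z‖ = ‖a i‖ ^ (q * (1 + z.re) / 2) := by
    intro i z hz
    rw [← hre, hα]
    exact norm_mul_norm_cpow_sub_one rfl (by rw [hre]; positivity)
  have hgn : ∀ x (z : ℂ), 0 ≤ z.re → ‖g z x‖ = ‖f x‖ ^ (p * (1 + z.re) / 2) := by
    intro x z hz
    rw [← hre, hg]
    exact norm_mul_norm_cpow_sub_one (by simp) (by rw [hre]; positivity)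
  have hgm : ∀ z, Measurable (g z) := by
    intro z
    have : Measurable fun x => (starRingEnd ℂ) (f x) := Complex.continuous_conj.measurable.comp hfm
    exact this.mul (measurable_ofReal_cpow hfm.norm _)
  have hgB : ∀ x (z : ℂ), 0 ≤ z.re → z.re ≤ 1 → ‖g z x‖ ≤ B ^ p := by
    intro x z h0 h1
    rw [hgn x z h0]
    refine (Real.rpow_le_rpow (norm_nonneg _) (hfB x) (by positivity)).trans
      (Real.rpow_le_rpow_of_exponent_le hB ?_)
    nlinarith
  set F : ℂ → ℂ := fun z => ∑ i ∈ s, α i z *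
    ∫ x, (χ i x * (starRingEnd ℂ) (f x)) * (‖f x‖ : ℂ) ^ (p * (1 + z) / 2 - 1) ∂μ with hF
  have hFint : ∀ z : ℂ, 0 ≤ z.re → z.re ≤ 1 →
      F z = ∫ x, (∑ i ∈ s, α i z * χ i x) * g z x ∂μ := by
    intro z h0 h1
    simp only [hF, Finset.sum_mul]
    rw [integral_finsetSum]
    · refine Finset.sum_congr rfl fun i _ => ?_
      rw [← integral_const_mul]
      simp only [hg, mul_assoc]
    · intro i _
      refine Integrable.of_bound (C := ‖α i z‖ * B ^ p)
        (((hχ i).const_mul _).mul (hgm z)).aestronglyMeasurable (Eventually.of_forall fun x => ?_)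
      rw [norm_mul, norm_mul]
      have := hgB x z h0 h1
      have h3 : ‖α i z‖ * ‖χ i x‖ ≤ ‖α i z‖ := mul_le_of_le_one_right (norm_nonneg _) (hχ1 i x)
      gcongr
  have hFle : ∀ z : ℂ, 0 ≤ z.re → z.re ≤ 1 →
      ‖F z‖ ≤ ∫ x, ‖∑ i ∈ s, α i z * χ i x‖ * ‖g z x‖ ∂μ := by
    intro z h0 h1
    rw [hFint z h0 h1]
    refine (norm_integral_le_integral_norm _).trans_eq ?_
    simp only [norm_mul]
  have hdiff : ∀ z : ℂ, 0 ≤ z.re → DifferentiableAt ℂ F z := by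
    intro z h0
    refine DifferentiableAt.fun_sum fun i _ => ?_
    refine DifferentiableAt.mul
      (differentiable_mul_norm_cpow (a i) (h := fun z => q * (1 + z) / 2 - 1) (by fun_prop) z) ?_
    refine DifferentiableAt.comp z (g := fun y : ℂ =>
        ∫ x, (χ i x * (starRingEnd ℂ) (f x)) * (‖f x‖ : ℂ) ^ y ∂μ)
      (f := fun z : ℂ => p * (1 + z) / 2 - 1) ?_ (by fun_prop)
    refine differentiableAt_integral_mul_cpow μ (C := B) (B := B) ?_ hfm.norm (fun x => ?_)
      (fun x => norm_nonneg _) hfB hB ?_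
    · exact (hχ i).mul (Complex.continuous_conj.measurable.comp hfm)
    · rw [norm_mul, RCLike.norm_conj]
      exact (mul_le_of_le_one_left (norm_nonneg _) (hχ1 i x)).trans (hfB x)
    · rw [Complex.sub_re, hre, Complex.one_re]
      nlinarith
  have hd : DiffContOnCl ℂ F (Complex.HadamardThreeLines.verticalStrip 0 1) := by
    refine DifferentiableOn.diffContOnCl fun z hz => (hdiff z ?_).differentiableWithinAt
    rw [Complex.HadamardThreeLines.verticalStrip, Complex.closure_preimage_re,
      closure_Ioo zero_ne_one] at hz
    exact hz.1
  have hbdd : BddAbove ((norm ∘ F) '' Complex.HadamardThreeLines.verticalClosedStrip 0 1) := by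
    refine ⟨(∑ i ∈ s, B ^ q) * B ^ p, ?_⟩
    rintro _ ⟨z, ⟨h0, h1⟩, rfl⟩
    simp only [Function.comp_apply]
    rw [hFint z h0 h1]
    refine (norm_integral_le_of_norm_le_const (C := (∑ i ∈ s, B ^ q) * B ^ p)
      (Eventually.of_forall fun x => ?_)).trans_eq (by simp)
    rw [norm_mul]
    refine mul_le_mul ((hsum_le _ x).trans (Finset.sum_le_sum fun i hi => ?_)) (hgB x z h0 h1)
      (norm_nonneg _) (Finset.sum_nonneg fun _ _ => by positivity)
    rw [hαn i z h0]
    refine (Real.rpow_le_rpow (norm_nonneg _) (haB i hi) (by positivity)).trans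
      (Real.rpow_le_rpow_of_exponent_le hB ?_)
    nlinarith
  have hleft : ∀ z ∈ Complex.re ⁻¹' {0}, ‖F z‖ ≤ (N * I) ^ (1 / 2 : ℝ) := by
    intro z hz
    replace hz : z.re = 0 := hz
    refine (hFle z hz.ge (by simp [hz])).trans ?_
    refine (integral_mul_le_Lp_mul_Lq_of_nonneg (p := 2) (q := 2) Real.HolderConjugate.two_two
      (Eventually.of_forall fun x => norm_nonneg _) (Eventually.of_forall fun x => norm_nonneg _)
      ?_ ?_).trans ?_
    · refine MemLp.of_bound (Measurable.aestronglyMeasurable (by fun_prop)) (∑ i ∈ s, ‖α i z‖)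
        (Eventually.of_forall fun x => ?_)
      rw [norm_norm]
      exact hsum_le _ x
    · refine MemLp.of_bound (hgm z).norm.aestronglyMeasurable (B ^ p)
        (Eventually.of_forall fun x => ?_)
      rw [norm_norm]
      exact hgB x z hz.ge (by simp [hz])
    · rw [Real.mul_rpow hN0 hI0]
      simp only [Real.rpow_two]
      have key : ∀ t c : ℝ, 0 ≤ t → (t ^ (c * (1 + 0) / 2)) ^ 2 = t ^ c := by
        intro t c ht
        rw [← Real.rpow_mul_natCast ht]
        congr 1
        push_cast
        ring
      have h1 : ∫ x, ‖∑ i ∈ s, α i z * χ i x‖ ^ 2 ∂μ ≤ N := by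
        refine (hbessel fun i => α i z).trans_eq (Finset.sum_congr rfl fun i _ => ?_)
        rw [hαn i z hz.ge, hz, key _ _ (norm_nonneg _)]
      have h2 : ∫ x, ‖g z x‖ ^ 2 ∂μ = I := by
        refine integral_congr_ae (Eventually.of_forall fun x => ?_)
        simp only [hgn x z hz.ge, hz, key _ _ (norm_nonneg _)]
      rw [h2]
      have := integral_nonneg (μ := μ) (f := fun x => ‖∑ i ∈ s, α i z * χ i x‖ ^ 2)
        fun x => by positivity
      gcongr
  have hright : ∀ z ∈ Complex.re ⁻¹' {1}, ‖F z‖ ≤ N * I := by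
    intro z hz
    replace hz : z.re = 1 := hz
    have hz0 : 0 ≤ z.re := by simp [hz]
    have key : ∀ c : ℝ, c * (1 + 1) / 2 = c := fun c => by ring
    refine (hFle z hz0 hz.le).trans ?_
    rw [hI, ← integral_const_mul]
    refine integral_mono_of_nonneg (Eventually.of_forall fun x => by positivity) ?_
      (Eventually.of_forall fun x => ?_)
    · refine Integrable.const_mul (Integrable.of_bound (C := B ^ p)
        (hfm.norm.pow_const p).aestronglyMeasurable (Eventually.of_forall fun x => ?_)) _
      rw [Real.norm_of_nonneg (by positivity)]
      exact Real.rpow_le_rpow (norm_nonneg _) (hfB x) hp0.le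
    · simp only [hgn x z hz0, hz, key]
      refine mul_le_mul_of_nonneg_right ((hsum_le _ x).trans_eq ?_) (by positivity)
      simp only [hαn _ z hz0, hz, key, hN]
  have hθ : (((1 - 2 / p : ℝ) : ℂ)).re = 1 - 2 / p := Complex.ofReal_re _
  have hθ0 : 0 ≤ 1 - 2 / p := by
    rw [sub_nonneg, div_le_one hp0]
    exact hp.le
  have hθ1 : 1 - 2 / p ≤ 1 := by
    rw [sub_le_self_iff]
    positivity
  have h3 := Complex.HadamardThreeLines.norm_le_interp_of_mem_verticalClosedStrip₀₁' F
    (z := ((1 - 2 / p : ℝ) : ℂ)) ⟨by rwa [hθ], by rwa [hθ]⟩ hd hbdd hleft hright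
  have hFθ : F ((1 - 2 / p : ℝ) : ℂ) = (I : ℂ) := by
    rw [hFint _ (by rwa [hθ]) (by rwa [hθ]), hI, ← integral_complex_ofReal]
    refine integral_congr_ae (Eventually.of_forall fun x => ?_)
    have e1 : ∀ i, α i ((1 - 2 / p : ℝ) : ℂ) = a i := by
      intro i
      have : (q * (1 + ((1 - 2 / p : ℝ) : ℂ)) / 2 - 1 : ℂ) = ((q * (1 - 1 / p) - 1 : ℝ) : ℂ) := by
        push_cast
        ring
      simp only [hα]
      rw [this, hq1]
      simp
    have e2 : (p * (1 + ((1 - 2 / p : ℝ) : ℂ)) / 2 - 1 : ℂ) = ((p - 2 : ℝ) : ℂ) := by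
      have : (p : ℂ) ≠ 0 := by exact_mod_cast hp0.ne'
      push_cast
      field_simp
      ring
    simp only [e1, hg]
    rw [e2, ← Complex.ofReal_cpow (norm_nonneg _), ← mul_assoc, Complex.mul_conj,
      ← Complex.ofReal_mul, Complex.normSq_eq_norm_sq, ← Real.rpow_two,
      ← Real.rpow_add_of_nonneg (norm_nonneg _) (by norm_num) (by linarith)]
    congr 2
    ring
  rw [hFθ, Complex.norm_real, Real.norm_of_nonneg hI0, hθ, ← Real.rpow_mul (by positivity),
    ← Real.rpow_add_of_nonneg (by positivity) (by simp; positivity) hθ0] at h3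
  have hexp : 1 / 2 * (1 - (1 - 2 / p)) + (1 - 2 / p) = 1 / q := by
    have := hpq.inv_add_inv_eq_one
    field_simp at this ⊢
    linarith
  rw [hexp, Real.mul_rpow hN0 hI0] at h3
  rcases hI0.eq_or_lt with h | h
  · rw [← h, Real.zero_rpow (by positivity)]
    positivity
  · have h4 : I = I ^ (1 / p) * I ^ (1 / q) := by
      rw [← Real.rpow_add h, one_div, one_div, hpq.inv_add_inv_eq_one, Real.rpow_one]
    have h5 : 0 < I ^ (1 / q) := by positivity
    refine le_of_mul_le_mul_right ?_ h5
    rwa [← h4]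

lemma torusMeasure_eq_pi (d : ℕ) :
    torusMeasure d = Measure.pi fun _ => AddCircle.haarAddCircle := by
  refine (Measure.pi_eq fun s _ => ?_).symm
  have h0 : ENNReal.ofReal (2 * Real.pi) ≠ 0 := by simp [Real.pi_pos]
  rw [torusMeasure, Measure.smul_apply, Measure.pi_pi]
  simp only [AddCircle.volume_eq_smul_haarAddCircle, Measure.smul_apply, smul_eq_mul,
    Finset.prod_mul_distrib, Finset.prod_const, Finset.card_univ, Fintype.card_fin]
  rw [← mul_assoc, ← mul_pow, ENNReal.inv_mul_cancel h0 ENNReal.ofReal_ne_top, one_pow, one_mul]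

instance isProbabilityMeasure_torusMeasure (d : ℕ) : IsProbabilityMeasure (torusMeasure d) := by
  rw [torusMeasure_eq_pi]
  infer_instance

lemma continuous_torusChar {d : ℕ} (k : ZLat d) : Continuous (torusChar k) := by
  unfold torusChar
  fun_prop

lemma norm_torusChar {d : ℕ} (k : ZLat d) (x : Torus d) : ‖torusChar k x‖ = 1 := by
  rw [torusChar, norm_prod]
  exact Finset.prod_eq_one fun j _ => Circle.norm_coe _

lemma fourierCoef_torusChar {d : ℕ} (k l : ZLat d) :
    fourierCoef (torusChar l) k = if k = l then 1 else 0 := by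
  have h (x : Torus d) : (starRingEnd ℂ) (torusChar k x) * torusChar l x =
      ∏ j, fourier (-k j) (x j) • fourier (l j) (x j) := by
    simp only [torusChar, map_prod, ← Finset.prod_mul_distrib, fourier_neg, smul_eq_mul]
  simp only [fourierCoef, h, torusMeasure_eq_pi]
  rw [integral_fintype_prod_eq_prod (fun j t => fourier (-k j) t • fourier (l j) t)]
  have h2 (j : Fin d) : ∫ t : AddCircle (2 * Real.pi), fourier (-k j) t • fourier (l j) t
      ∂AddCircle.haarAddCircle = if k j = l j then 1 else 0 := by
    change fourierCoeff (fourier (l j)) (k j) = _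
    rw [fourierCoeff_fourier, Pi.single_apply]
  simp only [h2, Finset.prod_ite_zero, Finset.prod_const_one, Finset.mem_univ, true_implies,
    funext_iff]

lemma integral_norm_sq_sum_torusChar {d : ℕ} (s : Finset (ZLat d)) (b : ZLat d → ℂ) :
    ∫ x, ‖∑ k ∈ s, b k * torusChar k x‖ ^ 2 ∂torusMeasure d = ∑ k ∈ s, ‖b k‖ ^ 2 := by
  have h (x : Torus d) : ((‖∑ k ∈ s, b k * torusChar k x‖ ^ 2 : ℝ) : ℂ) =
      ∑ k ∈ s, ∑ l ∈ s, (starRingEnd ℂ) (b k) * b l *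
        ((starRingEnd ℂ) (torusChar k x) * torusChar l x) := by
    rw [Complex.ofReal_pow, ← Complex.conj_mul', map_sum, Finset.sum_mul_sum]
    refine Finset.sum_congr rfl fun k _ => Finset.sum_congr rfl fun l _ => ?_
    rw [map_mul]
    ring
  have hint (k l : ZLat d) : Integrable (fun x => (starRingEnd ℂ) (b k) * b l *
      ((starRingEnd ℂ) (torusChar k x) * torusChar l x)) (torusMeasure d) := by
    refine Continuous.integrable_of_hasCompactSupport ?_ (HasCompactSupport.of_compactSpace _)
    have := continuous_torusChar k
    have := continuous_torusChar l
    fun_prop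
  apply Complex.ofReal_injective
  rw [← integral_complex_ofReal]
  simp only [h]
  rw [integral_finsetSum _ fun k _ => integrable_finsetSum _ fun l _ => hint k l]
  push_cast
  refine Finset.sum_congr rfl fun k hk => ?_
  rw [integral_finsetSum _ fun l _ => hint k l]
  simp only [integral_const_mul]
  have h2 (l : ZLat d) : ∫ x, (starRingEnd ℂ) (torusChar k x) * torusChar l x ∂torusMeasure d =
      if k = l then 1 else 0 := fourierCoef_torusChar k l
  simp only [h2, mul_ite, mul_one, mul_zero, Finset.sum_ite_eq, hk, if_true, Complex.conj_mul']

lemma integrable_conj_torusChar_mul {d : ℕ} (p : ℝ≥0∞) [Fact (1 ≤ p)] (k : ZLat d)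
    (f : Lp ℂ p (torusMeasure d)) :
    Integrable (fun x => (starRingEnd ℂ) (torusChar k x) * f x) (torusMeasure d) := by
  refine ((Lp.memLp f).integrable Fact.out).bdd_mul (c := 1)
    (Complex.continuous_conj.comp (continuous_torusChar k)).aestronglyMeasurable
    (Eventually.of_forall fun x => ?_)
  simp [norm_torusChar]

/-- The `k`-th Fourier coefficient as a continuous linear functional on `L_p(𝕋^d)`. -/
def fourierCoefCLM {d : ℕ} (p : ℝ≥0∞) [Fact (1 ≤ p)] (k : ZLat d) :
    Lp ℂ p (torusMeasure d) →L[ℂ] ℂ :=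
  LinearMap.mkContinuous
    { toFun := fun f => fourierCoef f k
      map_add' := fun f g => by
        rw [fourierCoef, fourierCoef, fourierCoef, ← integral_add
          (integrable_conj_torusChar_mul p k f) (integrable_conj_torusChar_mul p k g)]
        refine integral_congr_ae ?_
        filter_upwards [Lp.coeFn_add f g] with x hx
        rw [hx, Pi.add_apply, mul_add]
      map_smul' := fun c f => by
        rw [fourierCoef, fourierCoef, RingHom.id_apply, smul_eq_mul, ← integral_const_mul]
        refine integral_congr_ae ?_
        filter_upwards [Lp.coeFn_smul c f] with x hx
        rw [hx, Pi.smul_apply, smul_eq_mul]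
        ring }
    1 fun f => by
      have h1 : ‖fourierCoef f k‖ ≤ ∫ x, ‖f x‖ ∂torusMeasure d := by
        refine (norm_integral_le_integral_norm _).trans_eq ?_
        simp only [norm_mul, RCLike.norm_conj, norm_torusChar, one_mul]
      rw [one_mul, Lp.norm_def]
      refine h1.trans ?_
      rw [integral_norm_eq_lintegral_enorm (Lp.aestronglyMeasurable f),
        ← eLpNorm_one_eq_lintegral_enorm]
      exact ENNReal.toReal_mono (Lp.eLpNorm_ne_top f)
        (eLpNorm_le_eLpNorm_of_exponent_le Fact.out (Lp.aestronglyMeasurable f))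

@[simp]
lemma fourierCoefCLM_apply {d : ℕ} (p : ℝ≥0∞) [Fact (1 ≤ p)] (k : ZLat d)
    (f : Lp ℂ p (torusMeasure d)) : fourierCoefCLM p k f = fourierCoef f k :=
  rfl

/-- The character `e^{i k·x}` as an element of `L_p(𝕋^d)`. -/
def torusCharLp {d : ℕ} (p : ℝ≥0∞) [Fact (1 ≤ p)] (k : ZLat d) : Lp ℂ p (torusMeasure d) :=
  ContinuousMap.toLp p (torusMeasure d) ℂ ⟨torusChar k, continuous_torusChar k⟩

lemma fourierCoef_torusCharLp {d : ℕ} (p : ℝ≥0∞) [Fact (1 ≤ p)] (k l : ZLat d) :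
    fourierCoef (torusCharLp p l) k = if k = l then 1 else 0 := by
  rw [← fourierCoef_torusChar]
  refine integral_congr_ae ?_
  filter_upwards [ContinuousMap.coeFn_toLp (p := p) (𝕜 := ℂ) (torusMeasure d)
    ⟨torusChar l, continuous_torusChar l⟩] with x hx
  rw [torusCharLp, hx]
  rfl

lemma norm_sum_smul_torusCharLp_le {d : ℕ} {p : ℝ≥0∞} [Fact (1 ≤ p)] (hp2 : 2 < p) (hpt : p ≠ ⊤)
    {q : ℝ} (hpq : p.toReal.HolderConjugate q) (s : Finset (ZLat d)) (b : ZLat d → ℂ) :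
    ‖∑ k ∈ s, b k • torusCharLp p k‖ ≤ (∑ k ∈ s, ‖b k‖ ^ q) ^ (1 / q) := by
  have hp2' : 2 < p.toReal := by
    simpa using (ENNReal.toReal_lt_toReal (by simp) hpt).2 hp2
  have hp0 : p ≠ 0 := (zero_lt_two.trans hp2).ne'
  have h1 : ∑ k ∈ s, b k • torusCharLp p k = ContinuousMap.toLp p (torusMeasure d) ℂ
      (∑ k ∈ s, b k • (⟨torusChar k, continuous_torusChar k⟩ : C(Torus d, ℂ))) := by
    simp only [map_sum, map_smul, torusCharLp]
  have h2 := ContinuousMap.coeFn_toLp (p := p) (𝕜 := ℂ) (torusMeasure d)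
      (∑ k ∈ s, b k • (⟨torusChar k, continuous_torusChar k⟩ : C(Torus d, ℂ)))
  rw [h1, Lp.norm_def, (Lp.memLp _).eLpNorm_eq_integral_rpow_norm hp0 hpt,
    ENNReal.toReal_ofReal (by positivity), ← one_div]
  refine le_trans (le_of_eq ?_) (hausdorff_young (torusMeasure d) (χ := torusChar)
    (fun k => (continuous_torusChar k).measurable) (fun k x => (norm_torusChar k x).le) s
    (fun b => (integral_norm_sq_sum_torusChar s b).le) b hp2' hpq)
  congr 1
  refine integral_congr_ae ?_
  filter_upwards [h2] with x hx
  rw [hx]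
  simp [ContinuousMap.sum_apply]

/-- The rank-one operator sending `c` to `c(k) / w(k) · e^{i k·x}`. -/
def rankOneTerm {d : ℕ} (p : ℝ≥0∞) [Fact (1 ≤ p)] (w : ZLat d → ℝ) (k : ZLat d) :
    ellTwo d →L[ℂ] Lp ℂ p (torusMeasure d) :=
  (lp.evalCLM ℂ (fun _ : ZLat d => ℂ) 2 k).smulRight ((w k : ℂ)⁻¹ • torusCharLp p k)

lemma rankOneTerm_apply {d : ℕ} (p : ℝ≥0∞) [Fact (1 ≤ p)] (w : ZLat d → ℝ) (k : ZLat d)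
    (c : ellTwo d) : rankOneTerm p w k c = (c k / (w k : ℂ)) • torusCharLp p k := by
  rw [div_eq_mul_inv, mul_smul]
  rfl

lemma norm_sum_rankOneTerm_le {d : ℕ} {p : ℝ≥0∞} [Fact (1 ≤ p)] (hp2 : 2 < p) (hpt : p ≠ ⊤)
    {r : ℝ} (hr : 1 / r = 1 / 2 - 1 / p.toReal) {w : ZLat d → ℝ} (hw : ∀ k, 0 < w k)
    (s : Finset (ZLat d)) :
    ‖∑ k ∈ s, rankOneTerm p w k‖ ≤ (∑ k ∈ s, (w k)⁻¹ ^ r) ^ (1 / r) := by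
  have hp2' : 2 < p.toReal := by
    simpa using (ENNReal.toReal_lt_toReal (by simp) hpt).2 hp2
  have hpq : p.toReal.HolderConjugate p.toReal.conjExponent :=
    Real.HolderConjugate.conjExponent (by linarith)
  have hr0 : 0 < r := by
    rw [← one_div_pos, hr, sub_pos]
    exact one_div_lt_one_div_of_lt two_pos hp2'
  set q := p.toReal.conjExponent
  have htriple : r.HolderTriple 2 q := by
    refine ⟨?_, hr0, two_pos⟩
    have := hpq.inv_add_inv_eq_one
    rw [one_div, one_div, one_div] at hr
    linarith
  have hS : 0 ≤ ∑ k ∈ s, (w k)⁻¹ ^ r :=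
    Finset.sum_nonneg fun k _ => Real.rpow_nonneg (inv_nonneg.2 (hw k).le) _
  refine ContinuousLinearMap.opNorm_le_bound _ (Real.rpow_nonneg hS _) fun c => ?_
  simp only [_root_.sum_apply, rankOneTerm_apply]
  refine (norm_sum_smul_torusCharLp_le hp2 hpt hpq s fun k => c k / (w k : ℂ)).trans ?_
  have h1 := NNReal.Lr_le_Lp_mul_Lq s (fun k => ‖(w k)⁻¹‖₊) (fun k => ‖c k‖₊) htriple
  have h2 : (∑ k ∈ s, ‖c k‖ ^ (2 : ℝ)) ^ (1 / 2 : ℝ) ≤ ‖c‖ := by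
    have h3 := lp.sum_rpow_le_norm_rpow (p := 2) (by simp) c s
    rw [ENNReal.toReal_ofNat] at h3
    refine (Real.rpow_le_rpow (by positivity) h3 (by norm_num)).trans_eq ?_
    rw [← Real.rpow_mul (norm_nonneg _)]
    norm_num
  have h4 (k : ZLat d) : ‖(w k)⁻¹‖ = (w k)⁻¹ := Real.norm_of_nonneg (inv_nonneg.2 (hw k).le)
  rw [← NNReal.coe_le_coe] at h1
  push_cast at h1
  simp only [h4] at h1
  have h5 (k : ZLat d) : ‖c k / (w k : ℂ)‖ = (w k)⁻¹ * ‖c k‖ := by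
    rw [norm_div, Complex.norm_real, ← h4, norm_inv, div_eq_inv_mul]
  simp only [h5]
  exact h1.trans (mul_le_mul_of_nonneg_left h2 (Real.rpow_nonneg hS _))

lemma summable_rankOneTerm {d : ℕ} {p : ℝ≥0∞} [Fact (1 ≤ p)] (hp2 : 2 < p) (hpt : p ≠ ⊤)
    {r : ℝ} (hr0 : 0 < r) (hr : 1 / r = 1 / 2 - 1 / p.toReal) {w : ZLat d → ℝ}
    (hw : ∀ k, 0 < w k) (hsum : Summable fun k : ZLat d => (w k)⁻¹ ^ r) :
    Summable (rankOneTerm p w) := by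
  rw [summable_iff_vanishing_norm] at hsum ⊢
  intro ε hε
  obtain ⟨s, hs⟩ := hsum (ε ^ r) (by positivity)
  refine ⟨s, fun t ht => (norm_sum_rankOneTerm_le hp2 hpt hr hw t).trans_lt ?_⟩
  have hS : 0 ≤ ∑ k ∈ t, (w k)⁻¹ ^ r :=
    Finset.sum_nonneg fun k _ => Real.rpow_nonneg (inv_nonneg.2 (hw k).le) _
  have h := (le_abs_self _).trans_lt (hs t ht)
  refine (Real.rpow_lt_rpow hS h (by positivity)).trans_eq ?_
  rw [← Real.rpow_mul hε.le, mul_one_div_cancel hr0.ne', Real.rpow_one]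

lemma rank_range_sum_rankOneTerm_le {d : ℕ} (p : ℝ≥0∞) [Fact (1 ≤ p)] (w : ZLat d → ℝ)
    (s : Finset (ZLat d)) :
    Module.rank ℂ (LinearMap.range
      ((∑ k ∈ s, rankOneTerm p w k : ellTwo d →L[ℂ] Lp ℂ p (torusMeasure d)) :
        ellTwo d →ₗ[ℂ] Lp ℂ p (torusMeasure d))) ≤ s.card := by
  classical
  have hle : LinearMap.range
      ((∑ k ∈ s, rankOneTerm p w k : ellTwo d →L[ℂ] Lp ℂ p (torusMeasure d)) :
        ellTwo d →ₗ[ℂ] Lp ℂ p (torusMeasure d)) ≤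
      Submodule.span ℂ (s.image (torusCharLp p) : Set (Lp ℂ p (torusMeasure d))) := by
    rintro _ ⟨c, rfl⟩
    simp only [ContinuousLinearMap.coe_coe, _root_.sum_apply, rankOneTerm_apply]
    exact Submodule.sum_mem _ fun k hk => Submodule.smul_mem _ _
      (Submodule.subset_span (Finset.mem_coe.2 (Finset.mem_image_of_mem _ hk)))
  refine (Submodule.rank_mono hle).trans ((rank_span_finset_le _).trans ?_)
  exact_mod_cast Finset.card_image_le

/-- Proposition 8 of Cobos–Kühn–Sickel. Let `2 < p < ∞`, define `r`
by `1/r = 1/2 - 1/p`, and let `w` satisfy `∑_k w(k)^{-r} < ∞`.  Then `F_d(w)` embeds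
into `L_p(𝕋^d)` and `a_n(I_d : F_d(w) → L_p(𝕋^d)) ≤ (∑_{j=n}^∞ σ_j^r)^{1/r}`, where
`σ` (indexed from `0`) is the non-increasing rearrangement of `(1/w(k))_k`. -/
theorem statement18 (d : ℕ) (hd : 0 < d) (p : ℝ≥0∞) [Fact (1 ≤ p)]
    (hp2 : 2 < p) (hpt : p ≠ ⊤) (r : ℝ) (hr : 1 / r = 1 / 2 - 1 / p.toReal)
    (w : ZLat d → ℝ) (hw : ∀ k, 0 < w k)
    (hsum : Summable fun k : ZLat d => (w k)⁻¹ ^ r)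
    (σ : ℕ → ℝ) (hσ : Antitone σ) (e : ℕ ≃ ZLat d) (hσe : ∀ j, σ j = (w (e j))⁻¹) :
    ∃ T : ellTwo d →L[ℂ] Lp ℂ p (torusMeasure d),
      (∀ (c : ellTwo d) (k : ZLat d), fourierCoef (⇑(T c)) k = c k / (w k : ℂ)) ∧
      ∀ n : ℕ, approxNum T (n + 1) ≤ (∑' j : ℕ, σ (n + j) ^ r) ^ (1 / r) := by
  have hp2' : 2 < p.toReal := by
    simpa using (ENNReal.toReal_lt_toReal (by simp) hpt).2 hp2
  have hr0 : 0 < r := by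
    rw [← one_div_pos, hr, sub_pos]
    exact one_div_lt_one_div_of_lt two_pos hp2'
  have hT := summable_rankOneTerm hp2 hpt hr0 hr hw hsum
  refine ⟨∑' k, rankOneTerm p w k, fun c k => ?_, fun n => ?_⟩
  · have h1 : HasSum (fun l => fourierCoef (rankOneTerm p w l c) k)
        (fourierCoef ((∑' l, rankOneTerm p w l) c) k) := by
      simpa only [ContinuousLinearMap.comp_apply, ContinuousLinearMap.apply_apply,
        fourierCoefCLM_apply] using
        hT.hasSum.mapL ((fourierCoefCLM p k).comp (ContinuousLinearMap.apply ℂ _ c))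
    have h2 (l : ZLat d) : fourierCoef (rankOneTerm p w l c) k =
        if l = k then c k / (w k : ℂ) else 0 := by
      rw [← fourierCoefCLM_apply, rankOneTerm_apply, map_smul, fourierCoefCLM_apply,
        fourierCoef_torusCharLp, smul_eq_mul, mul_ite, mul_one, mul_zero]
      rcases eq_or_ne l k with rfl | h
      · simp
      · simp [h, h.symm]
    simp only [h2] at h1
    exact h1.unique (hasSum_ite_eq k _)
  · set A := ∑ k ∈ (Finset.range n).map e.toEmbedding, rankOneTerm p w k with hA
    have hσr : Summable fun j => σ j ^ r := by
      simp only [hσe]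
      exact (e.summable_iff (f := fun k => (w k)⁻¹ ^ r)).2 hsum
    have hσ0 : ∀ j, 0 ≤ σ j ^ r := fun j => by
      rw [hσe]
      exact Real.rpow_nonneg (inv_nonneg.2 (hw _).le) _
    have hσn : Summable fun j => σ (n + j) ^ r :=
      hσr.comp_injective (add_right_injective n)
    have hTe : Summable fun j => rankOneTerm p w (e j) := (e.summable_iff).2 hT
    have htail : (∑' k, rankOneTerm p w k) - A = ∑' j, rankOneTerm p w (e (j + n)) := by
      rw [← e.tsum_eq, ← hTe.sum_add_tsum_nat_add n, hA, Finset.sum_map]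
      simp
    have hbound : ‖(∑' k, rankOneTerm p w k) - A‖ ≤ (∑' j, σ (n + j) ^ r) ^ (1 / r) := by
      rw [htail]
      refine le_of_tendsto ((summable_nat_add_iff n).2 hTe).hasSum.norm
        (Eventually.of_forall fun s => ?_)
      let f : ℕ ↪ ZLat d := (addRightEmbedding n).trans e.toEmbedding
      have h := norm_sum_rankOneTerm_le hp2 hpt hr hw (s.map f)
      rw [Finset.sum_map, Finset.sum_map] at h
      refine h.trans (Real.rpow_le_rpow ?_ ?_ (by positivity))
      · exact Finset.sum_nonneg fun j _ => Real.rpow_nonneg (inv_nonneg.2 (hw _).le) _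
      · refine le_of_eq_of_le (Finset.sum_congr rfl fun j _ => ?_)
          (hσn.sum_le_tsum s fun j _ => hσ0 _)
        rw [hσe, add_comm]
        rfl
    unfold approxNum
    refine le_trans (csInf_le ⟨0, ?_⟩ ⟨A, ?_, rfl⟩) hbound
    · rintro _ ⟨_, _, rfl⟩
      exact norm_nonneg _
    · refine (rank_range_sum_rankOneTerm_le p w _).trans_lt ?_
      rw [Finset.card_map, Finset.card_range]
      exact_mod_cast n.lt_succ_self
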